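/- Let R be a commutative ring and ϖ ∈ R, and let S, T, T′ be as follows: S is the subring of M₂(R) of matrices (a b; c d) with c ∈ ϖR, T = R² with the standard S-action, and T′ = R² with the twisted S-action in which (a b; ϖc d) ∈ S acts by the matrix (d c; ϖb a). Then the image of the evaluation map Hom_S(T′, T) ⊗_R T′ → T, f ⊗ t′ ↦ f(t′), is the R-submodule R·(1,0) ⊕ ϖR·(0,1) of T = R², i.e., it equals e₁T ⊕ ϖ·e₂T. -/

import Mathlib

open Matrix

/-- The `R`-module of maps `T′ → T` that are linear over the order
`S = {(a b; c d) ∈ M₂(R) : c ∈ ϖR}`, where `T = R²` carries the standard `S`-action and `T′ = R²`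
carries the twisted `S`-action in which `(a b; ϖc d)` acts by the matrix `(d c; ϖb a)`. -/
def twistedHom (R : Type*) [CommRing R] (ϖ : R) :
    Submodule R ((Fin 2 → R) →ₗ[R] (Fin 2 → R)) where
  carrier := {f | ∀ (a b c d : R) (v : Fin 2 → R),
    f ((!![d, c; ϖ * b, a]).mulVec v) = (!![a, b; ϖ * c, d]).mulVec (f v)}
  add_mem' := by
    intro f g hf hg a b c d v
    simp only [LinearMap.add_apply, hf a b c d v, hg a b c d v, Matrix.mulVec_add]
  zero_mem' := by
    intro a b c d v
    simp only [LinearMap.zero_apply, Matrix.mulVec_zero]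
  smul_mem' := by
    intro r f hf a b c d v
    simp only [LinearMap.smul_apply, hf a b c d v, Matrix.mulVec_smul]

/-- The `S`-linear map `T′ → T` given by `(x, y) ↦ (y, ϖx)`. -/
def twistedSwap (R : Type*) [CommRing R] (ϖ : R) : (Fin 2 → R) →ₗ[R] (Fin 2 → R) :=
  Matrix.mulVecLin !![0, 1; ϖ, 0]

theorem twistedSwap_apply {R : Type*} [CommRing R] (ϖ : R) (v : Fin 2 → R) :
    twistedSwap R ϖ v = ![v 1, ϖ * v 0] := by
  ext i
  fin_cases i <;> simp [twistedSwap, Matrix.mulVec, dotProduct]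

theorem twistedSwap_mem_twistedHom (R : Type*) [CommRing R] (ϖ : R) :
    twistedSwap R ϖ ∈ twistedHom R ϖ := by
  intro a b c d v
  rw [twistedSwap_apply, twistedSwap_apply]
  ext i
  fin_cases i <;> simp [Matrix.mulVec, dotProduct] <;> ring

/-- Every element of `twistedHom R ϖ` is a scalar multiple of `twistedSwap R ϖ`. -/
theorem eq_smul_twistedSwap_of_mem_twistedHom {R : Type*} [CommRing R] {ϖ : R}
    {f : (Fin 2 → R) →ₗ[R] (Fin 2 → R)} (hf : f ∈ twistedHom R ϖ) :
    f = f (Pi.single 1 1) 0 • twistedSwap R ϖ := by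
  have key : ∀ (a b c d : R) (v : Fin 2 → R),
      f ((!![d, c; ϖ * b, a]).mulVec v) = (!![a, b; ϖ * c, d]).mulVec (f v) := hf
  have h₀ : f (Pi.single 0 1) 0 = 0 := by
    have h := congrFun (key 1 0 0 0 (Pi.single 0 1)) 0
    have e : (!![0, 0; ϖ * 0, 1] : Matrix (Fin 2) (Fin 2) R).mulVec (Pi.single 0 1) = 0 := by
      ext i; fin_cases i <;> simp [Matrix.mulVec, dotProduct]
    rw [e] at h
    simpa [Matrix.mulVec, dotProduct] using h.symm
  have h₁ : f (Pi.single 1 1) 1 = 0 := by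
    have h := congrFun (key 0 0 0 1 (Pi.single 1 1)) 1
    have e : (!![1, 0; ϖ * 0, 0] : Matrix (Fin 2) (Fin 2) R).mulVec (Pi.single 1 1) = 0 := by
      ext i; fin_cases i <;> simp [Matrix.mulVec, dotProduct]
    rw [e] at h
    simpa [Matrix.mulVec, dotProduct] using h.symm
  have h₂ : f (Pi.single 0 1) 1 = ϖ * f (Pi.single 1 1) 0 := by
    have h := congrFun (key 0 1 0 0 (Pi.single 0 1)) 0
    have e : (!![0, 0; ϖ * 1, 0] : Matrix (Fin 2) (Fin 2) R).mulVec (Pi.single 0 1)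
        = ϖ • Pi.single 1 1 := by
      ext i; fin_cases i <;> simp [Matrix.mulVec, dotProduct]
    rw [e, map_smul] at h
    simpa [Matrix.mulVec, dotProduct] using h.symm
  refine LinearMap.ext fun v => ?_
  have hv : v = v 0 • Pi.single 0 1 + v 1 • Pi.single 1 1 := by
    ext i; fin_cases i <;> simp
  have hfv : f v = v 0 • f (Pi.single 0 1) + v 1 • f (Pi.single 1 1) := by
    conv_lhs => rw [hv, map_add, map_smul, map_smul]
  rw [hfv, LinearMap.smul_apply, twistedSwap_apply]
  ext i
  fin_cases i
  · simp [h₀, mul_comm]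
  · simp [h₁, h₂]; ring

/-- The image of the evaluation map `Hom_S(T′, T) ⊗_R T′ → T`,
`f ⊗ t′ ↦ f(t′)`, is the `R`-submodule `R·(1,0) ⊕ ϖR·(0,1)` of `T = R²`, i.e. `e₁T ⊕ ϖ·e₂T`. -/
theorem twistedHom_evaluation_image (R : Type*) [CommRing R] (ϖ : R) :
    Submodule.span R {x : Fin 2 → R | ∃ f ∈ twistedHom R ϖ, ∃ v : Fin 2 → R, x = f v}
      = Submodule.span R ({Pi.single 0 1, Pi.single 1 ϖ} : Set (Fin 2 → R)) := by
  apply le_antisymm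
  · rw [Submodule.span_le]
    rintro _ ⟨f, hf, v, rfl⟩
    rw [SetLike.mem_coe, Submodule.mem_span_pair, eq_smul_twistedSwap_of_mem_twistedHom hf]
    generalize f (Pi.single 1 1) 0 = r
    refine ⟨r * v 1, r * v 0, ?_⟩
    rw [LinearMap.smul_apply, twistedSwap_apply]
    ext i
    fin_cases i
    · simp
    · simp; ring
  · rw [Submodule.span_le]
    rintro _ (rfl | rfl)
    · refine Submodule.subset_span
        ⟨twistedSwap R ϖ, twistedSwap_mem_twistedHom R ϖ, Pi.single 1 1, ?_⟩
      rw [twistedSwap_apply]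
      ext i
      fin_cases i <;> simp
    · refine Submodule.subset_span
        ⟨twistedSwap R ϖ, twistedSwap_mem_twistedHom R ϖ, Pi.single 0 1, ?_⟩
      rw [twistedSwap_apply]
      ext i
      fin_cases i <;> simp
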